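/- Let ℓ > 0 and μ ∈ ℝ, set τ := 2πi/ℓ, and assume θ₃(μ;τ) ≠ 0. Then for every z ∈ ℂ with z ∉ Λ_ℓ one has (π/2)²·f_μ(z)·f_μ(−z) = ℘(z;Λ_ℓ) − ℘(z_μ;Λ_ℓ). -/

import Mathlib

open Complex

noncomputable section

/-- Jacobi theta function `θ₁(w;τ)` with nome `q = exp(iπτ)`. -/
def theta1 (τ w : ℂ) : ℂ :=
  -Complex.I * ∑' n : ℤ, (-1 : ℂ) ^ n *
    Complex.exp (Real.pi * Complex.I * τ * ((n : ℂ) + 1 / 2) ^ 2) *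
    Complex.exp ((2 * (n : ℂ) + 1) * Real.pi * Complex.I * w)

/-- Jacobi theta function `θ₃(w;τ)` with nome `q = exp(iπτ)`. -/
def theta3 (τ w : ℂ) : ℂ :=
  ∑' n : ℤ, Complex.exp (Real.pi * Complex.I * τ * (n : ℂ) ^ 2) *
    Complex.exp (2 * Real.pi * Complex.I * (n : ℂ) * w)

/-- The modulus `τ = 2πi/ℓ`. -/
def tau (ℓ : ℝ) : ℂ := 2 * Real.pi * Complex.I / (ℓ : ℂ)

/-- The function `g_μ(w) = (2/(πi))·θ₁′(0;τ)·θ₃(w+μ;τ)/(θ₃(μ;τ)·θ₁(w;τ))` with `τ = 2πi/ℓ`. -/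
def gmu (ℓ μ : ℝ) (w : ℂ) : ℂ :=
  2 / (Real.pi * Complex.I) * deriv (theta1 (tau ℓ)) 0 * theta3 (tau ℓ) (w + (μ : ℂ)) /
    (theta3 (tau ℓ) (μ : ℂ) * theta1 (tau ℓ) w)

/-- The function `f_μ(z) = ℓ⁻¹ g_μ(z/ℓ)`. -/
def fmu (ℓ μ : ℝ) (z : ℂ) : ℂ := (ℓ : ℂ)⁻¹ * gmu ℓ μ (z / (ℓ : ℂ))

/-- The lattice `{m ω₁ + n ω₂ : m, n ∈ ℤ}`. -/
def lat (ω₁ ω₂ : ℂ) : Set ℂ := {z : ℂ | ∃ m n : ℤ, z = (m : ℂ) * ω₁ + (n : ℂ) * ω₂}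

/-- The Weierstrass `℘`-function for the lattice spanned by `ω₁, ω₂`:
`℘(z) = z⁻² + ∑_{ω ∈ Λ∖{0}} ((z−ω)⁻² − ω⁻²)`. -/
def wp (ω₁ ω₂ : ℂ) (z : ℂ) : ℂ :=
  1 / z ^ 2 + ∑' p : {p : ℤ × ℤ // p ≠ 0},
    (1 / (z - ((p.1.1 : ℂ) * ω₁ + (p.1.2 : ℂ) * ω₂)) ^ 2
      - 1 / ((p.1.1 : ℂ) * ω₁ + (p.1.2 : ℂ) * ω₂) ^ 2)

/-- The point `z_μ = (1/2 − μ)ℓ + πi`. -/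
def zmu (ℓ μ : ℝ) : ℂ := (1 / 2 - (μ : ℂ)) * (ℓ : ℂ) + Real.pi * Complex.I

open scoped Classical in
/-- The cycle sum `∑_{σ ∈ Cₙ} ∏_{k=1}^n f(z_{σ(k)} − z_k)`, where `Cₙ` is the set of
permutations of `{1,…,n}` consisting of a single `n`-cycle. -/
def cycleSum (n : ℕ) (f : ℂ → ℂ) (z : Fin n → ℂ) : ℂ :=
  ∑ σ ∈ Finset.univ.filter
      (fun σ : Equiv.Perm (Fin n) => σ.IsCycle ∧ σ.support = Finset.univ),
    ∏ k : Fin n, f (z (σ k) - z k)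

/-- The open horizontal strip `S = {0 < Im z < π}`. -/
def strip : Set ℂ := {z : ℂ | 0 < z.im ∧ z.im < Real.pi}

/-- The top substrip `S_ε = {π − ε < Im z < π}`. -/
def topStrip (ε : ℝ) : Set ℂ := {z : ℂ | Real.pi - ε < z.im ∧ z.im < Real.pi}

end

/-- Entire functions with the quasi-periodicity of degree two theta functions. -/
structure IsTh (τ : ℂ) (h : ℂ → ℂ) : Prop where
  diff : Differentiable ℂ h
  per : ∀ w, h (w + 1) = h w
  qper : ∀ w, h (w + τ) = cexp (-2 * Real.pi * I * τ - 4 * Real.pi * I * w) * h w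

/-- Fourier coefficient on the unit interval. -/
noncomputable def fc (h : ℂ → ℂ) (n : ℤ) : ℂ :=
  ∫ x in (0 : ℝ)..1, cexp (-(2 * Real.pi * I * n * x)) * h x

lemma shift_int (g : ℂ → ℂ) (hg : Differentiable ℂ g) (hp : ∀ w, g (w + 1) = g w) (t : ℝ) :
    ∫ x in (0 : ℝ)..1, g (x + t * I) = ∫ x in (0 : ℝ)..1, g x := by
  have h := Complex.integral_boundary_rect_eq_zero_of_differentiableOn g 0 (1 + t * I)
    hg.differentiableOn
  have e : ∀ y : ℝ, g (1 + y * I) = g (y * I) := fun y => by rw [add_comm, hp]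
  simp [e] at h
  rw [sub_eq_zero] at h
  exact h.symm

lemma fc_rec {t : ℝ} {h : ℂ → ℂ} (hh : IsTh (t * I) h) (n : ℤ) :
    fc h n = cexp (-(2 * Real.pi * I * (t * I) * (n + 1))) * fc h (n + 2) := by
  have := shift_int (fun w => cexp (-(2 * Real.pi * I * n * w)) * h w)
    (by have := hh.diff; fun_prop) (fun w => by
      simp only [hh.per]
      congr 1
      rw [show -(2 * Real.pi * I * n * (w + 1)) =
        -(2 * Real.pi * I * n * w) + ((-n : ℤ) : ℂ) * (2 * Real.pi * I) by push_cast; ring,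
        Complex.exp_add, Complex.exp_int_mul_two_pi_mul_I, mul_one]) t
  unfold fc
  rw [← this, ← intervalIntegral.integral_const_mul]
  congr 1
  ext x
  simp only [hh.qper]
  rw [← mul_assoc (cexp _) (cexp _), ← mul_assoc (cexp _) (cexp _), ← Complex.exp_add,
    ← Complex.exp_add]
  congr 2
  push_cast
  ring

lemma fc_all {t : ℝ} {h : ℂ → ℂ} (hh : IsTh (t * I) h) (h0 : fc h 0 = 0) (h1 : fc h 1 = 0)
    (n : ℤ) : fc h n = 0 := by
  have key : ∀ n : ℤ, fc h n = 0 ↔ fc h (n + 2) = 0 := fun n => by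
    rw [fc_rec hh n]; simp [Complex.exp_ne_zero]
  have : ∀ n : ℤ, fc h n = 0 ∧ fc h (n + 1) = 0 := by
    intro n
    induction n using Int.induction_on with
    | zero => exact ⟨h0, by simpa using h1⟩
    | succ k ih => exact ⟨ih.2, by
        have := (key _).1 ih.1
        rwa [show (k : ℤ) + 1 + 1 = k + 2 by ring]⟩
    | pred k ih => 
        refine ⟨(key _).2 ?_, ?_⟩
        · rw [show -(k : ℤ) - 1 + 2 = -k + 1 by ring]; exact ih.2
        · rw [show -(k : ℤ) - 1 + 1 = -k by ring]; exact ih.1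
  exact (this n).1

lemma freq_real (P : ℂ → Prop) (hP : ∀ x : ℝ, P x) : ∃ᶠ z in nhdsWithin (0 : ℂ) {0}ᶜ, P z := by
  have ht : Filter.Tendsto (fun x : ℝ => (x : ℂ)) (nhdsWithin 0 {0}ᶜ) (nhdsWithin 0 {0}ᶜ) := by
    apply tendsto_nhdsWithin_of_tendsto_nhds_of_eventually_within
    · exact (Complex.continuous_ofReal.tendsto' 0 0 (by simp)).mono_left nhdsWithin_le_nhds
    · filter_upwards [self_mem_nhdsWithin] with x hx
      simpa using hx
  exact ht.frequently (Filter.Frequently.of_forall hP)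

lemma entire_zero_of_real (h : ℂ → ℂ) (hd : Differentiable ℂ h) (hr : ∀ x : ℝ, h x = 0)
    (w : ℂ) : h w = 0 :=
  (hd.differentiableOn.analyticOnNhd isOpen_univ).eqOn_zero_of_preconnected_of_frequently_eq_zero
    isPreconnected_univ (Set.mem_univ 0) (freq_real _ hr) (Set.mem_univ w)

lemma isTh_zero {t : ℝ} {h : ℂ → ℂ} (hh : IsTh (t * I) h) (h0 : fc h 0 = 0) (h1 : fc h 1 = 0)
    (w : ℂ) : h w = 0 := by
  refine entire_zero_of_real h hh.diff (fun x => ?_) w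
  have hp : Function.Periodic (fun x : ℝ => h x) 1 := fun x => by
    simpa using hh.per x
  have hc : Continuous (fun x : ℝ => h x) := hh.diff.continuous.comp Complex.continuous_ofReal
  let F : C(UnitAddCircle, ℂ) := ⟨hp.lift, continuous_coinduced_dom.mpr hc⟩
  have hF : ∀ n, fourierCoeff F n = 0 := fun n => by
    refine Eq.trans ?_ (fc_all hh h0 h1 n)
    rw [fourierCoeff_eq_intervalIntegral _ n 0, fc, zero_add, div_one, one_smul]
    congr 1
    ext x
    rw [fourier_coe_apply, smul_eq_mul]
    congr 1
    push_cast
    congr 1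
    ring
  have hz : fourierCoeff F = fun _ => 0 := funext hF
  have := has_pointwise_sum_fourier_series_of_summable (f := F) (by rw [hz]; exact summable_zero)
    (x : UnitAddCircle)
  simp only [hF, zero_smul] at this
  exact (this.unique hasSum_zero)

lemma fc_lin {h k : ℂ → ℂ} (hh : Differentiable ℂ h) (hk : Differentiable ℂ k) (a b : ℂ) (n : ℤ) :
    fc (fun w => a * h w + b * k w) n = a * fc h n + b * fc k n := by
  unfold fc
  have c1 := hh.continuous
  have c2 := hk.continuous
  rw [← intervalIntegral.integral_const_mul, ← intervalIntegral.integral_const_mul,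
    ← intervalIntegral.integral_add]
  · congr 1; ext x; ring
  · apply Continuous.intervalIntegrable; fun_prop
  · apply Continuous.intervalIntegrable; fun_prop

lemma IsTh.lin {τ : ℂ} {h k : ℂ → ℂ} (hh : IsTh τ h) (hk : IsTh τ k) (a b : ℂ) :
    IsTh τ (fun w => a * h w + b * k w) := by
  refine ⟨?_, ?_, ?_⟩
  · have := hh.diff
    have := hk.diff
    fun_prop
  · intro w; simp only [hh.per, hk.per]
  · intro w; simp only [hh.qper, hk.qper]; ring

lemma isTh_dep {t : ℝ} {h₁ h₂ h₃ : ℂ → ℂ} (H₁ : IsTh (t * I) h₁) (H₂ : IsTh (t * I) h₂)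
    (H₃ : IsTh (t * I) h₃) (p : ℂ) (e₁ : h₁ p = 0) (e₂ : h₂ p = 0) (e₃ : h₃ p ≠ 0) (x y : ℂ) :
    h₁ x * h₂ y = h₁ y * h₂ x := by
  have d : fc h₁ 0 * fc h₂ 1 - fc h₁ 1 * fc h₂ 0 = 0 := by
    have A := H₁.lin H₂ (fc h₂ 0 * fc h₃ 1 - fc h₂ 1 * fc h₃ 0)
      (-(fc h₁ 0 * fc h₃ 1 - fc h₁ 1 * fc h₃ 0))
    have B := A.lin H₃ 1 (fc h₁ 0 * fc h₂ 1 - fc h₁ 1 * fc h₂ 0)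
    have := isTh_zero B (by rw [fc_lin A.diff H₃.diff, fc_lin H₁.diff H₂.diff]; ring)
      (by rw [fc_lin A.diff H₃.diff, fc_lin H₁.diff H₂.diff]; ring) p
    simp only [e₁, e₂] at this
    simpa [e₃] using this
  have K : ∀ (a b : ℂ), a * fc h₁ 0 + b * fc h₂ 0 = 0 → a * fc h₁ 1 + b * fc h₂ 1 = 0 →
      ∀ w, a * h₁ w + b * h₂ w = 0 := fun a b ha hb =>
    isTh_zero (H₁.lin H₂ a b) (by rw [fc_lin H₁.diff H₂.diff, ha])
      (by rw [fc_lin H₁.diff H₂.diff, hb])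
  by_cases h0 : fc h₁ 0 = 0
  · by_cases h1 : fc h₁ 1 = 0
    · have := isTh_zero H₁ h0 h1
      simp [this]
    · have := K (-fc h₂ 1) (fc h₁ 1) (by linear_combination -d) (by ring)
      apply mul_left_cancel₀ h1
      linear_combination h₁ x * this y - h₁ y * this x
  · have := K (-fc h₂ 0) (fc h₁ 0) (by ring) (by linear_combination d)
    apply mul_left_cancel₀ h0
    linear_combination h₁ x * this y - h₁ y * this x

lemma theta3_eq (τ w : ℂ) : theta3 τ w = jacobiTheta₂ w τ := by
  unfold theta3 jacobiTheta₂ jacobiTheta₂_term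
  refine tsum_congr fun n => ?_
  rw [← Complex.exp_add]
  congr 1
  ring

lemma theta3_diff {τ : ℂ} (hτ : 0 < τ.im) : Differentiable ℂ (theta3 τ) := by
  have : theta3 τ = fun w => jacobiTheta₂ w τ := funext (theta3_eq τ)
  rw [this]
  exact fun w => differentiableAt_jacobiTheta₂_fst w hτ

lemma theta3_per (τ w : ℂ) : theta3 τ (w + 1) = theta3 τ w := by
  simp only [theta3_eq, jacobiTheta₂_add_left]

lemma theta3_qper (τ w : ℂ) :
    theta3 τ (w + τ) = cexp (-Real.pi * I * (τ + 2 * w)) * theta3 τ w := by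
  simp only [theta3_eq, jacobiTheta₂_add_left']

lemma theta3_neg (τ w : ℂ) : theta3 τ (-w) = theta3 τ w := by
  simp only [theta3_eq, jacobiTheta₂_neg_left]

lemma theta3_qper' (τ w : ℂ) :
    theta3 τ (w - τ) = cexp (-Real.pi * I * (τ - 2 * w)) * theta3 τ w := by
  have := theta3_qper τ (-w)
  rw [← theta3_neg, show -(w - τ) = -w + τ by ring, this, theta3_neg]
  congr 2
  ring

lemma theta1_eq (τ w : ℂ) : theta1 τ w =
    -I * (cexp (Real.pi * I * τ / 4 + Real.pi * I * w) * theta3 τ (w + 1 / 2 + τ / 2)) := by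
  unfold theta1 theta3
  refine congrArg _ (Eq.trans (tsum_congr fun n => ?_) tsum_mul_left)
  have : (-1 : ℂ) ^ n = cexp (Real.pi * I * n) := by
    rw [← Complex.exp_pi_mul_I, ← Complex.exp_int_mul]
    congr 1
    ring
  rw [this]
  simp only [← Complex.exp_add]
  congr 1
  ring

lemma theta1_diff {τ : ℂ} (hτ : 0 < τ.im) : Differentiable ℂ (theta1 τ) := by
  rw [show theta1 τ = fun w => _ from funext (theta1_eq τ)]
  have := theta3_diff hτ
  fun_prop

lemma theta1_per (τ w : ℂ) : theta1 τ (w + 1) = -theta1 τ w := by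
  simp only [theta1_eq]
  rw [show w + 1 + 1 / 2 + τ / 2 = w + 1 / 2 + τ / 2 + 1 by ring, theta3_per,
    show Real.pi * I * τ / 4 + Real.pi * I * (w + 1) =
      Real.pi * I * τ / 4 + Real.pi * I * w + Real.pi * I by ring, Complex.exp_add _ (Real.pi * I),
    Complex.exp_pi_mul_I]
  ring

lemma neg_cexp (a : ℂ) : -cexp a = cexp (a + Real.pi * I) := by
  rw [Complex.exp_add, Complex.exp_pi_mul_I]
  ring

lemma theta1_qper (τ w : ℂ) :
    theta1 τ (w + τ) = -cexp (-Real.pi * I * (τ + 2 * w)) * theta1 τ w := by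
  simp only [theta1_eq]
  rw [show w + τ + 1 / 2 + τ / 2 = w + 1 / 2 + τ / 2 + τ by ring, theta3_qper]
  have : cexp (Real.pi * I * τ / 4 + Real.pi * I * (w + τ)) *
      cexp (-Real.pi * I * (τ + 2 * (w + 1 / 2 + τ / 2))) =
      -cexp (-Real.pi * I * (τ + 2 * w)) * cexp (Real.pi * I * τ / 4 + Real.pi * I * w) := by
    rw [← Complex.exp_add, neg_cexp, ← Complex.exp_add, Complex.exp_eq_exp_iff_exists_int]
    exact ⟨-1, by push_cast; ring⟩
  linear_combination -I * theta3 τ (w + 1 / 2 + τ / 2) * this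

lemma theta1_neg (τ w : ℂ) : theta1 τ (-w) = -theta1 τ w := by
  simp only [theta1_eq]
  rw [← theta3_neg, show -(-w + 1 / 2 + τ / 2) = w + 1 / 2 + τ / 2 - τ - 1 by ring,
    ← theta3_per, sub_add_cancel, theta3_qper']
  have : cexp (Real.pi * I * τ / 4 + Real.pi * I * (-w)) *
      cexp (-Real.pi * I * (τ - 2 * (w + 1 / 2 + τ / 2))) =
      -cexp (Real.pi * I * τ / 4 + Real.pi * I * w) := by
    rw [← Complex.exp_add, neg_cexp, Complex.exp_eq_exp_iff_exists_int]
    exact ⟨0, by push_cast; ring⟩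
  linear_combination -I * theta3 τ (w + 1 / 2 + τ / 2) * this

lemma theta1_zero (τ : ℂ) : theta1 τ 0 = 0 := by
  have := theta1_neg τ 0
  rw [neg_zero] at this
  linear_combination this / 2

lemma theta3_half (τ : ℂ) : theta3 τ (1 / 2 + τ / 2) = 0 := by
  have := theta1_zero τ
  rw [theta1_eq] at this
  simpa [Complex.exp_ne_zero] using this

lemma exp_sq (τ w : ℂ) : cexp (-2 * Real.pi * I * τ - 4 * Real.pi * I * w) =
    cexp (-Real.pi * I * (τ + 2 * w)) ^ 2 := by
  rw [← Complex.exp_nat_mul]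
  congr 1
  push_cast
  ring

lemma isTh_K {τ : ℂ} (hτ : 0 < τ.im) (u : ℂ) :
    IsTh τ (fun w => theta3 τ (u + w) * theta3 τ (u - w)) := by
  have hd := theta3_diff hτ
  refine ⟨by fun_prop, fun w => ?_, fun w => ?_⟩
  · rw [← add_assoc, theta3_per, ← theta3_per τ (u - (w + 1)),
      show u - (w + 1) + 1 = u - w by ring]
  · rw [← add_assoc, theta3_qper, ← sub_sub, theta3_qper', mul_mul_mul_comm, ← Complex.exp_add]
    congr 2
    ring

lemma theta1_nonzero {τ : ℂ} (h : ∀ w, theta1 τ w = 0) (w : ℂ) : theta3 τ w = 0 := by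
  have := h (w - 1 / 2 - τ / 2)
  rw [theta1_eq, show w - 1 / 2 - τ / 2 + 1 / 2 + τ / 2 = w by ring] at this
  simpa [Complex.exp_ne_zero] using this

lemma theta3_of_prod {τ : ℂ} (hτ : 0 < τ.im) (p : ℂ)
    (h : ∀ u : ℝ, theta3 τ (u + p) * theta3 τ (u - p) = 0) (w : ℂ) : theta3 τ w = 0 := by
  have hd := theta3_diff hτ
  have d1 : Differentiable ℂ fun u => theta3 τ (u + p) := by fun_prop
  have d2 : Differentiable ℂ fun u => theta3 τ (u - p) := by fun_prop
  have h' : ∀ u : ℂ, theta3 τ (u + p) * theta3 τ (u - p) = 0 :=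
    entire_zero_of_real (fun u => theta3 τ (u + p) * theta3 τ (u - p)) (d1.mul d2) h
  rcases (d1.differentiableOn.analyticOnNhd isOpen_univ).eq_zero_or_eq_zero_of_mul_eq_zero
    (d2.differentiableOn.analyticOnNhd isOpen_univ) (fun z _ => h' z) isPreconnected_univ with h | h
  · simpa using h (w - p) (Set.mem_univ _)
  · simpa using h (w + p) (Set.mem_univ _)

open PeriodPair in
/-- The period pair `(ℓ, 2πi)`. -/
noncomputable def LL (ℓ : ℝ) (hℓ : 0 < ℓ) : PeriodPair where
  ω₁ := ℓ
  ω₂ := 2 * Real.pi * I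
  indep := by
    rw [LinearIndependent.pair_iff]
    intro s t h
    have h1 := congrArg Complex.re h
    have h2 := congrArg Complex.im h
    simp at h1 h2
    have := Real.pi_ne_zero
    exact ⟨h1.resolve_right hℓ.ne', by tauto⟩

lemma mem_LL {ℓ : ℝ} (hℓ : 0 < ℓ) (z : ℂ) :
    z ∈ (LL ℓ hℓ).lattice ↔ z ∈ lat (ℓ : ℂ) (2 * Real.pi * I) := by
  rw [PeriodPair.mem_lattice]
  simp only [lat, Set.mem_ofPred_eq, LL, eq_comm]

lemma wp_eq {ℓ : ℝ} (hℓ : 0 < ℓ) (z : ℂ) :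
    wp (ℓ : ℂ) (2 * Real.pi * I) z = (LL ℓ hℓ).weierstrassP z := by
  have h := (LL ℓ hℓ).weierstrassPExcept_add 0 z
  simp at h
  rw [← h, wp, add_comm, one_div]
  congr 1
  unfold PeriodPair.weierstrassPExcept
  rw [← (LL ℓ hℓ).latticeEquivProd.symm.toEquiv.tsum_eq]
  have key := tsum_subtype {p : ℤ × ℤ | p ≠ 0} (fun p : ℤ × ℤ =>
    (1 / (z - ((p.1 : ℂ) * ℓ + (p.2 : ℂ) * (2 * Real.pi * I))) ^ 2
      - 1 / ((p.1 : ℂ) * ℓ + (p.2 : ℂ) * (2 * Real.pi * I)) ^ 2))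
  refine Eq.trans key (tsum_congr fun p => ?_)
  have e : ((LL ℓ hℓ).latticeEquivProd.symm p : ℂ) = p.1 * ℓ + p.2 * (2 * Real.pi * I) :=
    (LL ℓ hℓ).latticeEquiv_symm_apply p
  by_cases hp : p = 0
  · simp [hp]
  · have : ((LL ℓ hℓ).latticeEquivProd.symm p : ℂ) ≠ 0 := by
      simpa using hp
    simp only [LinearEquiv.coe_toEquiv]
    rw [if_neg this, e]
    simp [hp]

lemma tau_eq (ℓ : ℝ) : tau ℓ = ((2 * Real.pi / ℓ : ℝ) : ℂ) * I := by
  unfold tau; push_cast; ring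

lemma tau_im {ℓ : ℝ} (hℓ : 0 < ℓ) : 0 < (tau ℓ).im := by
  rw [tau_eq]
  simp only [Complex.mul_im, Complex.ofReal_re, Complex.ofReal_im, Complex.I_re, Complex.I_im]
  have := Real.pi_pos
  simp
  positivity

lemma theta1_lat1 (τ w : ℂ) (n : ℤ) : theta1 τ (w + n) = 0 ↔ theta1 τ w = 0 := by
  have key : ∀ w, theta1 τ (w + 1) = 0 ↔ theta1 τ w = 0 := fun w => by simp [theta1_per]
  induction n using Int.induction_on with
  | zero => simp
  | succ k ih =>
    refine Iff.trans ?_ ih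
    rw [← key (w + (k : ℤ))]; push_cast; rw [add_assoc]
  | pred k ih =>
    refine Iff.trans ?_ ih
    rw [← key]; push_cast; rw [show w + (-k - 1) + 1 = w + -(k : ℂ) by ring]

lemma theta1_lat2 (τ w : ℂ) (n : ℤ) : theta1 τ (w + n * τ) = 0 ↔ theta1 τ w = 0 := by
  have key : ∀ w, theta1 τ (w + τ) = 0 ↔ theta1 τ w = 0 := fun w => by
    simp [theta1_qper, Complex.exp_ne_zero]
  induction n using Int.induction_on with
  | zero => simp
  | succ k ih =>
    refine Iff.trans ?_ ih
    rw [← key (w + (k : ℤ) * τ)]; push_cast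
    rw [show w + (k + 1) * τ = w + k * τ + τ by ring]
  | pred k ih =>
    refine Iff.trans ?_ ih
    rw [← key]; push_cast; rw [show w + (-k - 1) * τ + τ = w + -(k : ℂ) * τ by ring]

lemma ell_tau {ℓ : ℝ} (hℓ : 0 < ℓ) : (ℓ : ℂ) * tau ℓ = 2 * Real.pi * I := by
  have : (ℓ : ℂ) ≠ 0 := by exact_mod_cast hℓ.ne'
  unfold tau; field_simp

lemma theta1_of_mem {ℓ : ℝ} (hℓ : 0 < ℓ) {w : ℂ} (hw : (ℓ : ℂ) * w ∈ (LL ℓ hℓ).lattice) :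
    theta1 (tau ℓ) w = 0 := by
  rw [mem_LL] at hw
  obtain ⟨m, n, h⟩ := hw
  have h0 : (ℓ : ℂ) ≠ 0 := by exact_mod_cast hℓ.ne'
  have : w = 0 + m + n * tau ℓ := by
    apply mul_left_cancel₀ h0
    rw [h, ← ell_tau hℓ]; ring
  rw [this, theta1_lat2, theta1_lat1, theta1_zero]

open scoped Classical in
/-- The entire function `(℘(ℓw) - c) θ₁(w)²`. -/
noncomputable def HH (ℓ : ℝ) (hℓ : 0 < ℓ) (c w : ℂ) : ℂ :=
  if (ℓ : ℂ) * w ∈ (LL ℓ hℓ).lattice then (deriv (theta1 (tau ℓ)) w / ℓ) ^ 2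
  else ((LL ℓ hℓ).weierstrassP (ℓ * w) - c) * theta1 (tau ℓ) w ^ 2

lemma HH_diff {ℓ : ℝ} (hℓ : 0 < ℓ) (c : ℂ) : Differentiable ℂ (HH ℓ hℓ c) := by
  intro w₀
  have h0 : (ℓ : ℂ) ≠ 0 := by exact_mod_cast hℓ.ne'
  have hd := theta1_diff (tau_im hℓ)
  by_cases hw : (ℓ : ℂ) * w₀ ∈ (LL ℓ hℓ).lattice
  · have hds : Differentiable ℂ (dslope (theta1 (tau ℓ)) w₀) := by
      rw [← differentiableOn_univ]
      exact (Complex.differentiableOn_dslope Filter.univ_mem).2 hd.differentiableOn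
    have hE : DifferentiableAt ℂ ((LL ℓ hℓ).weierstrassPExcept (ℓ * w₀)) (ℓ * w₀) :=
      ((LL ℓ hℓ).differentiableOn_weierstrassPExcept (ℓ * w₀)).differentiableAt
        ((LL ℓ hℓ).compl_lattice_sdiff_singleton_mem_nhds _)
    have hE' : DifferentiableAt ℂ
        (fun w => (LL ℓ hℓ).weierstrassPExcept (ℓ * w₀) (ℓ * w)) w₀ :=
      DifferentiableAt.comp w₀ hE (by fun_prop)
    have hG : DifferentiableAt ℂ (fun w => ((LL ℓ hℓ).weierstrassPExcept (ℓ * w₀) (ℓ * w)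
        - 1 / (ℓ * w₀) ^ 2 - c) * theta1 (tau ℓ) w ^ 2 +
        (dslope (theta1 (tau ℓ)) w₀ w / ℓ) ^ 2) w₀ := by
      have := hds w₀
      have := hd w₀
      fun_prop
    refine hG.congr_of_eventuallyEq ?_
    have hn : ∀ᶠ w in nhds w₀, (ℓ : ℂ) * w ∈ ((LL ℓ hℓ).lattice \ {(ℓ : ℂ) * w₀} : Set ℂ)ᶜ :=
      (by fun_prop : Continuous fun w : ℂ => (ℓ : ℂ) * w).continuousAt.eventually
        ((LL ℓ hℓ).compl_lattice_sdiff_singleton_mem_nhds _)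
    filter_upwards [hn] with w hw'
    by_cases e : w = w₀
    · subst e
      simp [HH, hw, theta1_of_mem hℓ hw]
    · have hm : (ℓ : ℂ) * w ∉ (LL ℓ hℓ).lattice := by
        intro hm
        exact hw' ⟨hm, by simpa [h0] using e⟩
      have hs : w - w₀ ≠ 0 := sub_ne_zero.2 e
      have hP := (LL ℓ hℓ).weierstrassPExcept_add ⟨_, hw⟩ (ℓ * w)
      simp only at hP
      rw [HH, if_neg hm, ← hP, dslope_of_ne _ e, slope_def_field, theta1_of_mem hℓ hw, ← mul_sub]
      generalize 1 / ((ℓ : ℂ) * w₀) ^ 2 = X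
      field_simp
      ring
  · have ho : IsOpen ((LL ℓ hℓ).lattice : Set ℂ)ᶜ := (LL ℓ hℓ).isClosed_lattice.isOpen_compl
    have hE : DifferentiableAt ℂ (LL ℓ hℓ).weierstrassP (ℓ * w₀) :=
      (LL ℓ hℓ).differentiableOn_weierstrassP.differentiableAt (ho.mem_nhds hw)
    have hE' : DifferentiableAt ℂ (fun w => (LL ℓ hℓ).weierstrassP (ℓ * w)) w₀ :=
      DifferentiableAt.comp w₀ hE (by fun_prop)
    have hG : DifferentiableAt ℂ (fun w => ((LL ℓ hℓ).weierstrassP (ℓ * w) - c) *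
        theta1 (tau ℓ) w ^ 2) w₀ := by
      have := hd w₀
      fun_prop
    refine hG.congr_of_eventuallyEq ?_
    have hn : ∀ᶠ w in nhds w₀, (ℓ : ℂ) * w ∈ ((LL ℓ hℓ).lattice : Set ℂ)ᶜ :=
      (by fun_prop : Continuous fun w : ℂ => (ℓ : ℂ) * w).continuousAt.eventually (ho.mem_nhds hw)
    filter_upwards [hn] with w hw'
    exact if_neg hw'

lemma isTh_HH {ℓ : ℝ} (hℓ : 0 < ℓ) (c : ℂ) : IsTh (tau ℓ) (HH ℓ hℓ c) := by
  have hd := theta1_diff (tau_im hℓ)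
  have m1 : (ℓ : ℂ) ∈ (LL ℓ hℓ).lattice := (LL ℓ hℓ).ω₁_mem_lattice
  have m2 : (ℓ : ℂ) * tau ℓ ∈ (LL ℓ hℓ).lattice := by
    rw [ell_tau hℓ]; exact (LL ℓ hℓ).ω₂_mem_lattice
  refine ⟨HH_diff hℓ c, fun w => ?_, fun w => ?_⟩
  · have i : (ℓ : ℂ) * (w + 1) ∈ (LL ℓ hℓ).lattice ↔ (ℓ : ℂ) * w ∈ (LL ℓ hℓ).lattice := by
      rw [mul_add, mul_one]; exact Submodule.add_mem_iff_left _ m1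
    have hder : deriv (theta1 (tau ℓ)) (w + 1) = -deriv (theta1 (tau ℓ)) w := by
      rw [← deriv_comp_add_const]
      simp only [theta1_per]
      exact deriv.neg
    have hP := (LL ℓ hℓ).weierstrassP_add_coe (ℓ * w) ⟨_, m1⟩
    simp only at hP
    by_cases hw : (ℓ : ℂ) * w ∈ (LL ℓ hℓ).lattice
    · rw [HH, HH, if_pos (i.2 hw), if_pos hw, hder]
      ring
    · rw [HH, HH, if_neg (mt i.1 hw), if_neg hw, mul_add, mul_one, hP, theta1_per]
      ring
  · have i : (ℓ : ℂ) * (w + tau ℓ) ∈ (LL ℓ hℓ).lattice ↔ (ℓ : ℂ) * w ∈ (LL ℓ hℓ).lattice := by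
      rw [mul_add]; exact Submodule.add_mem_iff_left _ m2
    have hP := (LL ℓ hℓ).weierstrassP_add_coe (ℓ * w) ⟨_, m2⟩
    simp only at hP
    rw [exp_sq]
    by_cases hw : (ℓ : ℂ) * w ∈ (LL ℓ hℓ).lattice
    · have hder : deriv (theta1 (tau ℓ)) (w + tau ℓ) =
          -cexp (-Real.pi * I * (tau ℓ + 2 * w)) * deriv (theta1 (tau ℓ)) w := by
        rw [← deriv_comp_add_const]
        simp only [theta1_qper]
        rw [deriv_fun_mul (by fun_prop) (hd w), theta1_of_mem hℓ hw]
        ring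
      rw [HH, HH, if_pos (i.2 hw), if_pos hw, hder]
      ring
    · rw [HH, HH, if_neg (mt i.1 hw), if_neg hw, mul_add, hP, theta1_qper]
      ring

lemma zmu_eq {ℓ : ℝ} (hℓ : 0 < ℓ) (u : ℝ) :
    zmu ℓ u = (ℓ : ℂ) * (1 / 2 + tau ℓ / 2 - u) := by
  have := ell_tau hℓ
  unfold zmu
  linear_combination -this / 2

lemma zmu_notMem {ℓ : ℝ} (hℓ : 0 < ℓ) (u : ℝ) : zmu ℓ u ∉ (LL ℓ hℓ).lattice := by
  rw [mem_LL]
  rintro ⟨m, n, h⟩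
  have h2 := congrArg Complex.im h
  simp [zmu] at h2
  have h3 : (1 : ℝ) = n * 2 := by
    apply mul_right_cancel₀ Real.pi_ne_zero
    linarith
  have h4 : (1 : ℤ) = n * 2 := by exact_mod_cast h3
  omega

lemma HH_zero {ℓ : ℝ} (hℓ : 0 < ℓ) (c : ℂ) :
    HH ℓ hℓ c 0 = (deriv (theta1 (tau ℓ)) 0 / ℓ) ^ 2 := by
  rw [HH, if_pos (by simp)]

lemma main_id {ℓ : ℝ} (hℓ : 0 < ℓ) {v : ℂ} (hv : theta3 (tau ℓ) v ≠ 0) (u : ℝ) (w : ℂ) :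
    HH ℓ hℓ ((LL ℓ hℓ).weierstrassP (zmu ℓ u)) w * theta3 (tau ℓ) u ^ 2 =
    (deriv (theta1 (tau ℓ)) 0 / ℓ) ^ 2 * (theta3 (tau ℓ) (u + w) * theta3 (tau ℓ) (u - w)) := by
  have hτ := tau_im hℓ
  obtain ⟨x, hx⟩ : ∃ x : ℝ, theta3 (tau ℓ) (x + (1 / 2 + tau ℓ / 2 - u)) *
      theta3 (tau ℓ) (x - (1 / 2 + tau ℓ / 2 - u)) ≠ 0 := by
    by_contra! hcon
    exact hv (theta3_of_prod hτ _ hcon v)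
  have h1 := isTh_HH hℓ ((LL ℓ hℓ).weierstrassP (zmu ℓ u))
  have h2 := isTh_K hτ (u : ℂ)
  have h3 := isTh_K hτ (x : ℂ)
  have e1 : HH ℓ hℓ ((LL ℓ hℓ).weierstrassP (zmu ℓ u)) (1 / 2 + tau ℓ / 2 - u) = 0 := by
    rw [HH, if_neg, ← zmu_eq hℓ, sub_self, zero_mul]
    rw [← zmu_eq hℓ]
    exact zmu_notMem hℓ u
  rw [← HH_zero hℓ ((LL ℓ hℓ).weierstrassP (zmu ℓ u))]
  generalize HH ℓ hℓ ((LL ℓ hℓ).weierstrassP (zmu ℓ u)) = H at *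
  rw [tau_eq] at h1 h2 h3
  rw [tau_eq] at e1 hx ⊢
  have := isTh_dep h1 h2 h3 _ e1 (by
    rw [add_sub_cancel, theta3_half, zero_mul]) hx w 0
  simp only [add_zero, sub_zero] at this
  rw [sq]
  exact this

lemma deriv_theta1_ne {ℓ : ℝ} (hℓ : 0 < ℓ) {u : ℝ} (hu : theta3 (tau ℓ) u ≠ 0) :
    deriv (theta1 (tau ℓ)) 0 ≠ 0 := by
  intro h0
  have hl : (ℓ : ℂ) ≠ 0 := by exact_mod_cast hℓ.ne'
  have hm := main_id hℓ hu u
  rw [h0] at hm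
  generalize (LL ℓ hℓ).weierstrassP (zmu ℓ u) = c at hm
  have hH : ∀ w, HH ℓ hℓ c w = 0 := fun w => by
    have := hm w
    simpa [hu] using this
  have hE : ContinuousAt ((LL ℓ hℓ).weierstrassPExcept 0) (ℓ * 0) := by
    rw [mul_zero]
    exact (((LL ℓ hℓ).differentiableOn_weierstrassPExcept 0).differentiableAt
        ((LL ℓ hℓ).compl_lattice_sdiff_singleton_mem_nhds _)).continuousAt
  have hE' : ContinuousAt (fun w : ℂ => (LL ℓ hℓ).weierstrassPExcept 0 (ℓ * w)) 0 :=
    ContinuousAt.comp (f := fun w : ℂ => (ℓ : ℂ) * w) hE (by fun_prop)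
  have hF : ContinuousAt (fun w : ℂ => ((LL ℓ hℓ).weierstrassPExcept 0 (ℓ * w) - c) *
      (ℓ * w) ^ 2 + 1) 0 := by fun_prop
  have hne := hF.eventually_ne (y := 0) (by simp)
  have hn : ∀ᶠ w in nhds (0 : ℂ), (ℓ : ℂ) * w ∈ ((LL ℓ hℓ).lattice \ {(ℓ : ℂ) * 0} : Set ℂ)ᶜ :=
      (by fun_prop : Continuous fun w : ℂ => (ℓ : ℂ) * w).continuousAt.eventually
        ((LL ℓ hℓ).compl_lattice_sdiff_singleton_mem_nhds _)
  have hz : ∀ᶠ w in nhdsWithin (0 : ℂ) {0}ᶜ, theta1 (tau ℓ) w = 0 := by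
    filter_upwards [hne.filter_mono nhdsWithin_le_nhds, hn.filter_mono nhdsWithin_le_nhds,
      self_mem_nhdsWithin] with w w1 w2 w3
    have w3 : w ≠ 0 := w3
    have hmem : (ℓ : ℂ) * w ∉ (LL ℓ hℓ).lattice := by
      intro hm
      exact w2 ⟨hm, by simpa [hl] using w3⟩
    have := hH w
    rw [HH, if_neg hmem] at this
    rcases mul_eq_zero.1 this with h | h
    · exfalso
      apply w1
      have hP := (LL ℓ hℓ).weierstrassPExcept_add 0 (ℓ * w)
      simp at hP
      rw [← hP] at h
      have : ((ℓ : ℂ) * w) ^ 2 * ((ℓ * w) ^ 2)⁻¹ = 1 := mul_inv_cancel₀ (by simp [hl, w3])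
      linear_combination ((ℓ : ℂ) * w) ^ 2 * h - this
    · simpa using h
  have hd := theta1_diff (tau_im hℓ)
  have hall : ∀ w, theta1 (tau ℓ) w = 0 := fun w =>
    (hd.differentiableOn.analyticOnNhd isOpen_univ).eqOn_zero_of_preconnected_of_frequently_eq_zero
      isPreconnected_univ (Set.mem_univ 0) hz.frequently (Set.mem_univ w)
  exact hu (theta1_nonzero hall _)

lemma theta1_ne {ℓ : ℝ} (hℓ : 0 < ℓ) {u : ℝ} (hu : theta3 (tau ℓ) u ≠ 0) {w : ℂ}
    (hw : (ℓ : ℂ) * w ∉ (LL ℓ hℓ).lattice) : theta1 (tau ℓ) w ≠ 0 := by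
  intro h
  have hl : (ℓ : ℂ) ≠ 0 := by exact_mod_cast hℓ.ne'
  refine hu (theta3_of_prod (tau_im hℓ) w (fun x => ?_) _)
  have := main_id hℓ hu x w
  rw [HH, if_neg hw, h] at this
  have hd := deriv_theta1_ne hℓ hu
  have h2 : (deriv (theta1 (tau ℓ)) 0 / ℓ) ^ 2 ≠ 0 := pow_ne_zero _ (div_ne_zero hd hl)
  apply mul_left_cancel₀ h2
  rw [← this]
  ring

/-- Lemma 3.8: `(π/2)² f_μ(z) f_μ(−z) = ℘(z;Λ_ℓ) − ℘(z_μ;Λ_ℓ)`. -/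
theorem stmt4 (ℓ μ : ℝ) (hℓ : 0 < ℓ)
    (hμ : theta3 (tau ℓ) (μ : ℂ) ≠ 0) :
    ∀ z : ℂ, z ∉ lat (ℓ : ℂ) (2 * Real.pi * Complex.I) →
      ((Real.pi : ℂ) / 2) ^ 2 * fmu ℓ μ z * fmu ℓ μ (-z) =
        wp (ℓ : ℂ) (2 * Real.pi * Complex.I) z
          - wp (ℓ : ℂ) (2 * Real.pi * Complex.I) (zmu ℓ μ) := by
  intro z hz
  have hl : (ℓ : ℂ) ≠ 0 := by exact_mod_cast hℓ.ne'
  have hpi : (Real.pi : ℂ) ≠ 0 := by exact_mod_cast Real.pi_ne_zero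
  have hzw : (ℓ : ℂ) * (z / ℓ) = z := by field_simp
  have hw : (ℓ : ℂ) * (z / ℓ) ∉ (LL ℓ hℓ).lattice := by rwa [hzw, mem_LL]
  have h1 := theta1_ne hℓ hμ hw
  have hm := main_id hℓ hμ μ (z / ℓ)
  rw [HH, if_neg hw, hzw] at hm
  rw [wp_eq hℓ, wp_eq hℓ]
  generalize (LL ℓ hℓ).weierstrassP z - (LL ℓ hℓ).weierstrassP (zmu ℓ μ) = X at *
  unfold fmu gmu
  rw [neg_div, theta1_neg, add_comm (z / (ℓ : ℂ)), neg_add_eq_sub]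
  generalize deriv (theta1 (tau ℓ)) 0 = D at *
  generalize theta1 (tau ℓ) (z / ℓ) = T at *
  generalize theta3 (tau ℓ) (μ + z / ℓ) = A at *
  generalize theta3 (tau ℓ) (μ - z / ℓ) = B at *
  generalize theta3 (tau ℓ) μ = M at *
  have hX : X = (D / ℓ) ^ 2 * (A * B) / (T ^ 2 * M ^ 2) := by
    rw [eq_div_iff (by positivity), ← hm]
    ring
  rw [hX]
  have hI : I ^ 2 = -1 := Complex.I_sq
  field_simp
  rw [hI]
  ring
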